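/- arXiv:1109.0795 — 7 statements merged into one kernel-verified Lean document; each statement's English description precedes it below -/
import Mathlib

section
/- Let n be a finite type, M an n×n complex matrix, and ψ : n → ℂ. Then ⟨R(ψ), R(M) *ᵥ R(ψ)⟩ = Re⟨ψ, M *ᵥ ψ⟩ (the real part of the original expectation value, coerced to ℂ). -/
open Matrix Kronecker Complex

/-- The 2×2 change-of-basis matrix V = (1/√2)·[[1,1],[i,-i]]. -/
noncomputable def Vmat : Matrix (Fin 2) (Fin 2) ℂ :=
  ((Real.sqrt 2 : ℂ))⁻¹ • !![1, 1; Complex.I, -Complex.I]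

/-- The 2×2 matrix J with rows (0,-1) and (1,0). -/
def Jmat : Matrix (Fin 2) (Fin 2) ℂ := !![0, -1; 1, 0]

/-- The real simulation of a state: R(ψ)(0,a) = Re(ψ a), R(ψ)(1,a) = Im(ψ a). -/
noncomputable def Rvec {n : Type*} (ψ : n → ℂ) : Fin 2 × n → ℂ :=
  fun p => if p.1 = 0 then ((ψ p.2).re : ℂ) else ((ψ p.2).im : ℂ)

/-- The real simulation of an operator: R(M) = I₂ ⊗ₖ Re M + J ⊗ₖ Im M. -/
noncomputable def Rmat {n : Type*} [DecidableEq n] (M : Matrix n n ℂ) :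
    Matrix (Fin 2 × n) (Fin 2 × n) ℂ :=
  (1 : Matrix (Fin 2) (Fin 2) ℂ) ⊗ₖ M.map (fun z => (z.re : ℂ))
    + Jmat ⊗ₖ M.map (fun z => (z.im : ℂ))

/-- The real simulation intertwines matrix-vector multiplication. -/
theorem Rmat_mulVec_Rvec {n : Type*} [Fintype n] [DecidableEq n] (M : Matrix n n ℂ)
    (ψ : n → ℂ) : Rmat M *ᵥ Rvec ψ = Rvec (M *ᵥ ψ) := by
  ext ⟨i, a⟩
  fin_cases i
  · simp [Rmat, Rvec, Jmat, mulVec, dotProduct, Fintype.sum_prod_type, Complex.re_sum,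
      sub_eq_add_neg, Finset.sum_add_distrib]
  · simp [Rmat, Rvec, Jmat, mulVec, dotProduct, Fintype.sum_prod_type, Complex.im_sum,
      Finset.sum_add_distrib, add_comm]

/-- The inner product of real simulations is the real part of the inner product. -/
theorem sum_star_Rvec_mul_Rvec {n : Type*} [Fintype n] (φ ψ : n → ℂ) :
    ∑ p, star (Rvec φ p) * Rvec ψ p = (((∑ a, star (φ a) * ψ a).re : ℝ) : ℂ) := by
  simp [Rvec, Fintype.sum_prod_type, Complex.re_sum, Finset.sum_add_distrib]

/-- ⟨R(ψ), R(M) *ᵥ R(ψ)⟩ = Re ⟨ψ, M *ᵥ ψ⟩ (coerced to ℂ). -/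
theorem real_sim_expectation
    {n : Type*} [Fintype n] [DecidableEq n] (M : Matrix n n ℂ) (ψ : n → ℂ) :
    ∑ p, star (Rvec ψ p) * (Rmat M *ᵥ Rvec ψ) p
      = (((∑ a, star (ψ a) * (M *ᵥ ψ) a).re : ℝ) : ℂ) := by
  rw [Rmat_mulVec_Rvec, sum_star_Rvec_mul_Rvec]
end

section
/- Let n be a finite type and M an n×n complex matrix. Then R(M) is unitary (R(M)†·R(M) = I) if and only if M is unitary (M†·M = I), where † denotes conjugate transpose. -/
open Matrix Kronecker Complex

theorem Rmat_one {n : Type*} [DecidableEq n] : Rmat (1 : Matrix n n ℂ) = 1 := by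
  have hre : (1 : Matrix n n ℂ).map (fun z => (z.re : ℂ)) = 1 := by
    ext a b
    by_cases h : a = b <;> simp [Matrix.one_apply, h]
  have him : (1 : Matrix n n ℂ).map (fun z => (z.im : ℂ)) = 0 := by
    ext a b
    by_cases h : a = b <;> simp [h]
  simp [Rmat, hre, him]

theorem Rmat_conjTranspose {n : Type*} [DecidableEq n] (M : Matrix n n ℂ) :
    (Rmat M)ᴴ = Rmat Mᴴ := by
  ext ⟨i, a⟩ ⟨j, b⟩
  fin_cases i <;> fin_cases j <;> simp [Rmat, Jmat]

theorem Rmat_mul {n : Type*} [Fintype n] [DecidableEq n] (M N : Matrix n n ℂ) :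
    Rmat (M * N) = Rmat M * Rmat N := by
  ext ⟨i, a⟩ ⟨j, b⟩
  fin_cases i <;> fin_cases j <;>
    simp [Rmat, Jmat, Matrix.mul_apply, Fintype.sum_prod_type, Finset.sum_add_distrib,
      sub_eq_add_neg, add_comm]

theorem Rmat_injective {n : Type*} [DecidableEq n] :
    Function.Injective (Rmat : Matrix n n ℂ → _) := by
  intro M N h
  ext a b
  have hre := congrFun₂ h (0, a) (0, b)
  have him := congrFun₂ h (1, a) (0, b)
  simp only [Rmat, Jmat, Matrix.add_apply, Matrix.kroneckerMap_apply, Matrix.map_apply] at hre him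
  apply Complex.ext
  · simpa using hre
  · simpa using him

/-- R(M) is unitary iff M is unitary. -/
theorem real_sim_unitary_iff
    {n : Type*} [Fintype n] [DecidableEq n] (M : Matrix n n ℂ) :
    (Rmat M)ᴴ * Rmat M = 1 ↔ Mᴴ * M = 1 := by
  rw [Rmat_conjTranspose, ← Rmat_mul, ← Rmat_one, Rmat_injective.eq_iff]
end

section
/- Let n, m be finite types and J a finite index type. Let (A_j)_{j∈J} be Hermitian n×n complex matrices, (B_j)_{j∈J} Hermitian m×m complex matrices, and set M = Σ_j A_j ⊗ₖ B_j. Let ψ₁ : n → ℂ, ψ₂ : m → ℂ and ψ = ψ₁ ⊗ ψ₂ (the vector on n × m with ψ(a,b) = ψ₁ a · ψ₂ b). For z = (z₁,z₂) ∈ Fin 2 × Fin 2 define M^{*z} = Σ_j A_j^{(z₁)} ⊗ₖ B_j^{(z₂)} and ψ^{*z} = ψ₁^{(z₁)} ⊗ ψ₂^{(z₂)}, where X^{(0)} = X and X^{(1)} = conj X. Define the vector ψ' on (Fin 2 × Fin 2) × (n × m) by ψ'(z, a) = (1/2)·ψ^{*z}(a), and the matrix M' by M'((z,a),(w,b)) =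 M^{*z}(a,b) if z = w and 0 otherwise. Then ⟨ψ', M' *ᵥ ψ'⟩ = ⟨ψ, M *ᵥ ψ⟩. -/
open Matrix Kronecker Complex

/-- Conjugate a matrix when the bit is 1: X⁽⁰⁾ = X, X⁽¹⁾ = conj X. -/
def condConjM {n : Type*} (b : Fin 2) (A : Matrix n n ℂ) : Matrix n n ℂ :=
  if b = 0 then A else A.map (starRingEnd ℂ)

/-- Conjugate a vector when the bit is 1: v⁽⁰⁾ = v, v⁽¹⁾ = conj v. -/
def condConjV {n : Type*} (b : Fin 2) (v : n → ℂ) : n → ℂ :=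
  if b = 0 then v else fun a => star (v a)

/-- The expectation of a Hermitian matrix is unchanged by conjugating both matrix and vector. -/
lemma condConj_expectation {n : Type*} [Fintype n] (b : Fin 2) {A : Matrix n n ℂ}
    (hA : Aᴴ = A) (v : n → ℂ) :
    star (condConjV b v) ⬝ᵥ (condConjM b A *ᵥ condConjV b v) = star v ⬝ᵥ (A *ᵥ v) := by
  by_cases hb : b = 0
  · simp [condConjV, condConjM, hb]
  · have hentry (i j : n) : star (A i j) = A j i := congrFun (congrFun hA j) i
    simp only [condConjV, condConjM, hb, if_false, dotProduct, mulVec, Pi.star_apply, star_star,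
      Matrix.map_apply, starRingEnd_apply, hentry, Finset.mul_sum]
    rw [Finset.sum_comm]
    refine Finset.sum_congr rfl fun i _ => Finset.sum_congr rfl fun j _ => ?_
    ring

/-- The expectation of a Kronecker product in a product vector factors. -/
lemma kronecker_expectation {n m : Type*} [Fintype n] [Fintype m]
    (A : Matrix n n ℂ) (B : Matrix m m ℂ) (v : n → ℂ) (w : m → ℂ) :
    (star fun p : n × m => v p.1 * w p.2) ⬝ᵥ ((A ⊗ₖ B) *ᵥ fun p => v p.1 * w p.2) =
      (star v ⬝ᵥ (A *ᵥ v)) * (star w ⬝ᵥ (B *ᵥ w)) := by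
  have hmul : ((A ⊗ₖ B) *ᵥ fun p : n × m => v p.1 * w p.2) =
      fun p => (A *ᵥ v) p.1 * (B *ᵥ w) p.2 := by
    ext p
    simp only [mulVec, dotProduct, kroneckerMap_apply, Fintype.sum_prod_type, Finset.sum_mul_sum]
    refine Finset.sum_congr rfl fun i _ => Finset.sum_congr rfl fun j _ => ?_
    ring
  rw [hmul]
  simp only [dotProduct, Pi.star_apply, star_mul', Fintype.sum_prod_type, Finset.sum_mul_sum]
  refine Finset.sum_congr rfl fun i _ => Finset.sum_congr rfl fun j _ => ?_
  ring

/-- Each partial conjugation preserves the expectation of a sum of Kronecker products of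
Hermitian matrices in a product vector. -/
lemma partialConj_expectation {n m J : Type*} [Fintype n] [Fintype m] [Fintype J]
    {A : J → Matrix n n ℂ} {B : J → Matrix m m ℂ}
    (hA : ∀ j, (A j)ᴴ = A j) (hB : ∀ j, (B j)ᴴ = B j)
    (v : n → ℂ) (w : m → ℂ) (z : Fin 2 × Fin 2) :
    (star fun p : n × m => condConjV z.1 v p.1 * condConjV z.2 w p.2) ⬝ᵥ
        ((∑ j, condConjM z.1 (A j) ⊗ₖ condConjM z.2 (B j)) *ᵥ
          fun p => condConjV z.1 v p.1 * condConjV z.2 w p.2) =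
      (star fun p : n × m => v p.1 * w p.2) ⬝ᵥ
        ((∑ j, A j ⊗ₖ B j) *ᵥ fun p => v p.1 * w p.2) := by
  simp only [sum_mulVec, dotProduct_sum, kronecker_expectation, condConj_expectation _ (hA _),
    condConj_expectation _ (hB _)]

/-- the separable real simulation (before the change of basis), built from
the partial complex conjugations M^{*z} and ψ^{*z} indexed by z ∈ Fin 2 × Fin 2, has the
same expectation value as the original separable computation. -/
theorem separable_real_sim_partial_conjugation
    {n m : Type*} [Fintype n] [Fintype m] [DecidableEq n] [DecidableEq m]
    {J : Type*} [Fintype J]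
    (A : J → Matrix n n ℂ) (B : J → Matrix m m ℂ)
    (hA : ∀ j, (A j)ᴴ = A j) (hB : ∀ j, (B j)ᴴ = B j)
    (M : Matrix (n × m) (n × m) ℂ) (hM : M = ∑ j, A j ⊗ₖ B j)
    (ψ₁ : n → ℂ) (ψ₂ : m → ℂ)
    (ψ : n × m → ℂ) (hψ : ψ = fun p => ψ₁ p.1 * ψ₂ p.2)
    (Mz : Fin 2 × Fin 2 → Matrix (n × m) (n × m) ℂ)
    (hMz : ∀ z, Mz z = ∑ j, condConjM z.1 (A j) ⊗ₖ condConjM z.2 (B j))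
    (ψz : Fin 2 × Fin 2 → n × m → ℂ)
    (hψz : ∀ z, ψz z = fun p => condConjV z.1 ψ₁ p.1 * condConjV z.2 ψ₂ p.2)
    (ψ' : (Fin 2 × Fin 2) × (n × m) → ℂ)
    (hψ' : ∀ z a, ψ' (z, a) = (1 / 2 : ℂ) * ψz z a)
    (M' : Matrix ((Fin 2 × Fin 2) × (n × m)) ((Fin 2 × Fin 2) × (n × m)) ℂ)
    (hM' : ∀ z a w b, M' (z, a) (w, b) = if z = w then Mz z a b else 0) :
    ∑ p, star (ψ' p) * (M' *ᵥ ψ') p = ∑ p, star (ψ p) * (M *ᵥ ψ) p := by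
  have hM'ψ' (z : Fin 2 × Fin 2) (a : n × m) :
      (M' *ᵥ ψ') (z, a) = 1 / 2 * (Mz z *ᵥ ψz z) a := by
    simp only [mulVec, dotProduct]
    rw [Fintype.sum_prod_type, Fintype.sum_eq_single z, Finset.mul_sum]
    · refine Finset.sum_congr rfl fun b _ => ?_
      rw [hM', hψ', if_pos rfl]
      ring
    · intro w hw
      simp [hM', hw.symm]
  have hz (z : Fin 2 × Fin 2) : star (ψz z) ⬝ᵥ (Mz z *ᵥ ψz z) = star ψ ⬝ᵥ (M *ᵥ ψ) := by
    rw [hψz, hMz, hψ, hM, partialConj_expectation hA hB]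
  calc
    ∑ p, star (ψ' p) * (M' *ᵥ ψ') p
        = ∑ z, 1 / 4 * (star (ψz z) ⬝ᵥ (Mz z *ᵥ ψz z)) := by
      rw [Fintype.sum_prod_type]
      refine Finset.sum_congr rfl fun z _ => ?_
      rw [dotProduct, Finset.mul_sum]
      refine Finset.sum_congr rfl fun a _ => ?_
      have hhalf : star (1 / 2 : ℂ) = 1 / 2 := by simp
      rw [hM'ψ', hψ', star_mul', hhalf, Pi.star_apply]
      ring
    _ = star ψ ⬝ᵥ (M *ᵥ ψ) := by simp [hz]
    _ = ∑ p, star (ψ p) * (M *ᵥ ψ) p := rfl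
end

section
/- Let n, m be finite types and J a finite index type. Let (A_j)_{j∈J} be Hermitian n×n complex matrices, (B_j)_{j∈J} Hermitian m×m complex matrices, and set M = Σ_j A_j ⊗ₖ B_j. Let ψ₁ : n → ℂ and ψ₂ : m → ℂ. Then ⟨R(ψ₁) ⊗ R(ψ₂), (Σ_j R(A_j) ⊗ₖ R(B_j)) *ᵥ (R(ψ₁) ⊗ R(ψ₂))⟩ = ⟨ψ₁ ⊗ ψ₂, M *ᵥ (ψ₁ ⊗ ψ₂)⟩, where φ ⊗ χ denotes the tensor-product vector (φ ⊗ χ)(a,b) = φ a · χ b. (The real simulation of a separable two-prover verifier, applied to the two provers' real simulated proofs, accepts with exactly the original probability.) -/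
open Matrix Kronecker Complex

/-- The sesquilinear form of a Kronecker product factors on product vectors. -/
lemma star_dotProduct_kronecker_mulVec {n m : Type*} [Fintype n] [Fintype m]
    (A : Matrix n n ℂ) (B : Matrix m m ℂ) (φ : n → ℂ) (χ : m → ℂ) :
    star (fun q : n × m => φ q.1 * χ q.2) ⬝ᵥ (A ⊗ₖ B) *ᵥ (fun q : n × m => φ q.1 * χ q.2)
      = (star φ ⬝ᵥ A *ᵥ φ) * (star χ ⬝ᵥ B *ᵥ χ) := by
  have h : ∀ a b, ((A ⊗ₖ B) *ᵥ (fun q : n × m => φ q.1 * χ q.2)) (a, b)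
      = (A *ᵥ φ) a * (B *ᵥ χ) b := by
    intro a b
    simp only [mulVec, dotProduct, kroneckerMap_apply, Fintype.sum_prod_type,
      Finset.sum_mul_sum]
    exact Finset.sum_congr rfl fun _ _ => Finset.sum_congr rfl fun _ _ => by ring
  rw [dotProduct, dotProduct, dotProduct, Fintype.sum_prod_type, Finset.sum_mul_sum]
  refine Finset.sum_congr rfl fun a _ => Finset.sum_congr rfl fun b _ => ?_
  rw [h]
  simp only [Pi.star_apply, star_mul']
  ring

/-- The real simulation of an operator computes the real part of its sesquilinear form. -/
lemma star_Rvec_dotProduct_Rmat_mulVec {n : Type*} [Fintype n] [DecidableEq n]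
    (A : Matrix n n ℂ) (ψ : n → ℂ) :
    star (Rvec ψ) ⬝ᵥ Rmat A *ᵥ Rvec ψ = ((star ψ ⬝ᵥ A *ᵥ ψ).re : ℂ) := by
  simp only [mulVec, dotProduct, Fintype.sum_prod_type, Fin.sum_univ_two, Finset.mul_sum,
    re_sum, ofReal_sum, ← Finset.sum_add_distrib]
  refine Finset.sum_congr rfl fun a _ => Finset.sum_congr rfl fun b _ => ?_
  simp [Rvec, Rmat, Jmat]
  ring

/-- The real simulation preserves the quadratic form of a Hermitian operator. -/
lemma star_Rvec_dotProduct_Rmat_mulVec_of_isHermitian {n : Type*} [Fintype n] [DecidableEq n]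
    {A : Matrix n n ℂ} (hA : A.IsHermitian) (ψ : n → ℂ) :
    star (Rvec ψ) ⬝ᵥ Rmat A *ᵥ Rvec ψ = star ψ ⬝ᵥ A *ᵥ ψ := by
  rw [star_Rvec_dotProduct_Rmat_mulVec]
  exact Complex.ext rfl (hA.im_star_dotProduct_mulVec_self ψ).symm

/-- the real simulation of a separable two-prover verifier, applied to the
two provers' real simulated proofs, accepts with exactly the original probability. -/
theorem separable_real_sim_completeness
    {n m : Type*} [Fintype n] [Fintype m] [DecidableEq n] [DecidableEq m]
    {J : Type*} [Fintype J]
    (A : J → Matrix n n ℂ) (B : J → Matrix m m ℂ)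
    (hA : ∀ j, (A j)ᴴ = A j) (hB : ∀ j, (B j)ᴴ = B j)
    (M : Matrix (n × m) (n × m) ℂ) (hM : M = ∑ j, A j ⊗ₖ B j)
    (ψ₁ : n → ℂ) (ψ₂ : m → ℂ) :
    ∑ p, star ((fun q : (Fin 2 × n) × (Fin 2 × m) => Rvec ψ₁ q.1 * Rvec ψ₂ q.2) p)
        * ((∑ j, Rmat (A j) ⊗ₖ Rmat (B j))
            *ᵥ (fun q : (Fin 2 × n) × (Fin 2 × m) => Rvec ψ₁ q.1 * Rvec ψ₂ q.2)) p
      = ∑ p, star ((fun q : n × m => ψ₁ q.1 * ψ₂ q.2) p)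
        * (M *ᵥ (fun q : n × m => ψ₁ q.1 * ψ₂ q.2)) p := by
  subst hM
  change star (fun q : (Fin 2 × n) × (Fin 2 × m) => Rvec ψ₁ q.1 * Rvec ψ₂ q.2)
      ⬝ᵥ (∑ j, Rmat (A j) ⊗ₖ Rmat (B j)) *ᵥ _
    = star (fun q : n × m => ψ₁ q.1 * ψ₂ q.2) ⬝ᵥ (∑ j, A j ⊗ₖ B j) *ᵥ _
  simp only [sum_mulVec, dotProduct_sum, star_dotProduct_kronecker_mulVec,
    star_Rvec_dotProduct_Rmat_mulVec_of_isHermitian (hA _),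
    star_Rvec_dotProduct_Rmat_mulVec_of_isHermitian (hB _)]
end

section
/- Let n be a finite type and ψ : n → ℂ. Then R(i•ψ) = (J ⊗ₖ Iₙ) *ᵥ R(ψ), where i•ψ is the scalar multiple of ψ by the imaginary unit, J is the 2×2 matrix with rows (0,-1) and (1,0), and Iₙ is the n×n identity matrix. Consequently ⟨R(i•ψ), R(ψ)⟩ = 0, even though i•ψ and ψ are proportional: multiplying a state by a global phase i makes its real simulation exactly distinguishable (orthogonal) via an operation on the extra qubit alone. -/
open Matrix Kronecker Complex

/-- multiplying a state by the global phase i acts on the real simulation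
as J ⊗ₖ I on the extra qubit, and makes the real simulation orthogonal to the original:
R(i•ψ) = (J ⊗ₖ I) *ᵥ R(ψ) and ⟨R(i•ψ), R(ψ)⟩ = 0. -/
theorem real_sim_global_phase_distinguishable
    {n : Type*} [Fintype n] [DecidableEq n] (ψ : n → ℂ) :
    Rvec (Complex.I • ψ) = (Jmat ⊗ₖ (1 : Matrix n n ℂ)) *ᵥ Rvec ψ
    ∧ ∑ p, star (Rvec (Complex.I • ψ) p) * Rvec ψ p = 0 := by
  refine ⟨?_, ?_⟩
  · ext ⟨k, a⟩
    fin_cases k <;>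
      simp [Rvec, Jmat, mulVec, dotProduct, Fintype.sum_prod_type, Fin.sum_univ_two, one_apply]
  · rw [Fintype.sum_prod_type, Fin.sum_univ_two, ← Finset.sum_add_distrib]
    refine Finset.sum_eq_zero fun a _ => ?_
    simp [Rvec]
    ring
end

section
/- Fix m : ℕ with m ≥ 1, a finite type n, j k : Fin m, n×n complex matrices M and N, and ψ : n → ℂ. Then R⁽ᵐ⁾(M *ᵥ (N *ᵥ ψ)) = R⁽ᵐ⁾_j(M) *ᵥ (R⁽ᵐ⁾_k(N) *ᵥ R⁽ᵐ⁾(ψ)), for any (possibly different) choices of extra-qubit indices j and k. -/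
open Matrix Kronecker Complex

/-- The m-fold tensor power V^{⊗m}, indexed by bit strings Fin m → Fin 2. -/
noncomputable def Vtens (m : ℕ) : Matrix (Fin m → Fin 2) (Fin m → Fin 2) ℂ :=
  fun z w => ∏ j, Vmat (z j) (w j)

/-- The coherent mixture χ = (1/√2)(|0…0⟩|ψ⟩ + |1…1⟩|ψ*⟩). -/
noncomputable def chiVec {n : Type*} (m : ℕ) (ψ : n → ℂ) : (Fin m → Fin 2) × n → ℂ :=
  fun p =>
    if p.1 = fun _ => (0 : Fin 2) then ((Real.sqrt 2 : ℂ))⁻¹ * ψ p.2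
    else if p.1 = fun _ => (1 : Fin 2) then ((Real.sqrt 2 : ℂ))⁻¹ * star (ψ p.2)
    else 0

/-- The multi-party real simulation R⁽ᵐ⁾(ψ) of a state, with m "extra" qubits. -/
noncomputable def Rm {n : Type*} [Fintype n] [DecidableEq n] (m : ℕ) (ψ : n → ℂ) :
    (Fin m → Fin 2) × n → ℂ :=
  (Vtens m ⊗ₖ (1 : Matrix n n ℂ)) *ᵥ chiVec m ψ

/-- D_j(M): apply M when the j-th extra qubit reads 0 and conj M when it reads 1. -/
def Dj {n : Type*} (m : ℕ) (j : Fin m) (M : Matrix n n ℂ) :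
    Matrix ((Fin m → Fin 2) × n) ((Fin m → Fin 2) × n) ℂ :=
  fun p q =>
    if p.1 = q.1 then (if p.1 j = 0 then M p.2 q.2 else star (M p.2 q.2)) else 0

/-- The multi-party real simulation R⁽ᵐ⁾_j(M) of an operator applied by the j-th party. -/
noncomputable def Rmj {n : Type*} [Fintype n] [DecidableEq n] (m : ℕ) (j : Fin m)
    (M : Matrix n n ℂ) :
    Matrix ((Fin m → Fin 2) × n) ((Fin m → Fin 2) × n) ℂ :=
  (Vtens m ⊗ₖ (1 : Matrix n n ℂ)) * Dj m j M * (Vtens m ⊗ₖ (1 : Matrix n n ℂ))ᴴ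

theorem conjTranspose_Vmat_mul_self : Vmatᴴ * Vmat = 1 := by
  have h : ((Real.sqrt 2 : ℂ))⁻¹ * ((Real.sqrt 2 : ℂ))⁻¹ = 1 / 2 := by
    rw [← mul_inv, ← Complex.ofReal_mul, Real.mul_self_sqrt (by norm_num)]
    norm_num
  rw [Vmat, conjTranspose_smul, smul_mul_smul_comm, star_inv₀, Complex.star_def,
    Complex.conj_ofReal, h]
  ext a b
  fin_cases a <;> fin_cases b <;> norm_num [Matrix.mul_apply, Fin.sum_univ_two]

theorem conjTranspose_Vtens_mul_self (m : ℕ) : (Vtens m)ᴴ * Vtens m = 1 := by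
  ext z w
  have h : ((Vtens m)ᴴ * Vtens m) z w = ∏ j, (Vmatᴴ * Vmat) (z j) (w j) := by
    simp only [Matrix.mul_apply, conjTranspose_apply, Vtens, star_prod, ← Finset.prod_mul_distrib]
    exact (Fintype.prod_sum fun j a => star (Vmat a (z j)) * Vmat a (w j)).symm
  rw [h, conjTranspose_Vmat_mul_self]
  simp only [Matrix.one_apply, Fintype.prod_ite_zero, Finset.prod_const_one, funext_iff]

theorem Dj_mulVec_chiVec {n : Type*} [Fintype n] (m : ℕ) (j : Fin m) (M : Matrix n n ℂ)
    (ψ : n → ℂ) : Dj m j M *ᵥ chiVec m ψ = chiVec m (M *ᵥ ψ) := by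
  ext ⟨z, a⟩
  simp only [mulVec, dotProduct, Dj, Fintype.sum_prod_type_right, ite_mul, zero_mul,
    Finset.sum_ite_eq, Finset.mem_univ, if_true, chiVec]
  split_ifs with h₀ hj h₁ hj <;>
    simp_all [Finset.mul_sum, mul_left_comm]

theorem Rmj_mulVec_Rm {n : Type*} [Fintype n] [DecidableEq n] (m : ℕ) (j : Fin m)
    (M : Matrix n n ℂ) (ψ : n → ℂ) : Rmj m j M *ᵥ Rm m ψ = Rm m (M *ᵥ ψ) := by
  have h : (Vtens m ⊗ₖ (1 : Matrix n n ℂ))ᴴ * (Vtens m ⊗ₖ (1 : Matrix n n ℂ)) = 1 := by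
    rw [conjTranspose_kronecker, ← mul_kronecker_mul, conjTranspose_Vtens_mul_self,
      conjTranspose_one, one_mul, one_kronecker_one]
  rw [Rmj, Rm, Rm, mulVec_mulVec, mul_assoc, h, mul_one, ← mulVec_mulVec, Dj_mulVec_chiVec]

/-- R⁽ᵐ⁾(M *ᵥ (N *ᵥ ψ)) = R⁽ᵐ⁾_j(M) *ᵥ (R⁽ᵐ⁾_k(N) *ᵥ R⁽ᵐ⁾(ψ)) for any
choices of extra-qubit indices j and k. -/
theorem multiparty_real_sim_mulVec
    {m : ℕ} (hm : 1 ≤ m) {n : Type*} [Fintype n] [DecidableEq n]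
    (j k : Fin m) (M N : Matrix n n ℂ) (ψ : n → ℂ) :
    Rm m (M *ᵥ (N *ᵥ ψ)) = Rmj m j M *ᵥ (Rmj m k N *ᵥ Rm m ψ) := by
  rw [Rmj_mulVec_Rm, Rmj_mulVec_Rm]
end

section
/- Fix m : ℕ with m ≥ 1, a finite type n, and ψ : n → ℂ. Then every entry of R⁽ᵐ⁾(ψ) is real, i.e. Im(R⁽ᵐ⁾(ψ)(z,a)) = 0 for every z : Fin m → Fin 2 and a : n. (The multi-party real simulation of an arbitrary complex state is a state over the real numbers.) -/
open Matrix Kronecker Complex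

theorem star_Vmat_zero (i : Fin 2) : star (Vmat i 0) = Vmat i 1 := by
  fin_cases i <;> simp [Vmat]

theorem star_Vtens_zero (m : ℕ) (z : Fin m → Fin 2) :
    star (Vtens m z fun _ => 0) = Vtens m z fun _ => 1 := by
  simp only [Vtens, star_prod, star_Vmat_zero]

theorem Rm_apply {n : Type*} [Fintype n] [DecidableEq n] (m : ℕ) (ψ : n → ℂ)
    (z : Fin m → Fin 2) (a : n) :
    Rm m ψ (z, a) = ∑ w, Vtens m z w * chiVec m ψ (w, a) := by
  simp [Rm, mulVec, dotProduct, Fintype.sum_prod_type, kroneckerMap_apply, one_apply]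

theorem Rm_apply_eq_add_star {m : ℕ} (hm : 1 ≤ m) {n : Type*} [Fintype n] [DecidableEq n]
    (ψ : n → ℂ) (z : Fin m → Fin 2) (a : n) :
    Rm m ψ (z, a) = Vtens m z (fun _ => 0) * ((Real.sqrt 2 : ℂ)⁻¹ * ψ a) +
      star (Vtens m z (fun _ => 0) * ((Real.sqrt 2 : ℂ)⁻¹ * ψ a)) := by
  have hne : (fun _ : Fin m => (0 : Fin 2)) ≠ fun _ => 1 := fun h =>
    zero_ne_one (congrFun h ⟨0, hm⟩)
  rw [Rm_apply, Fintype.sum_eq_add _ _ hne]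
  · have hs : star ((Real.sqrt 2 : ℂ)⁻¹) = (Real.sqrt 2 : ℂ)⁻¹ := by simp
    simp only [chiVec, if_true, if_neg hne.symm, star_mul', star_Vtens_zero, hs]
  · rintro w ⟨h0, h1⟩
    simp only [chiVec, if_neg h0, if_neg h1, mul_zero]

/-- the multi-party real simulation of an arbitrary complex state is a
state over the real numbers: every entry of R⁽ᵐ⁾(ψ) has zero imaginary part. -/
theorem multiparty_real_sim_is_real
    {m : ℕ} (hm : 1 ≤ m) {n : Type*} [Fintype n] [DecidableEq n] (ψ : n → ℂ) :
    ∀ (z : Fin m → Fin 2) (a : n), (Rm m ψ (z, a)).im = 0 := by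
  intro z a
  rw [Rm_apply_eq_add_star hm]
  simp only [add_im, star_def, conj_im, add_neg_cancel]
end
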